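/- Let q be an odd prime power, let c ∈ F_{q^6} satisfy c^2 + c = 1, and let U_c = {(x, x^q + x^{q^3} + c·x^{q^5}) : x ∈ F_{q^6}} ⊆ F_{q^6} × F_{q^6}. Then the group of F_{q^6}-linear bijections φ of F_{q^6} × F_{q^6} such that φ(U_c) = U_c has exactly q^2 − 1 elements. -/

import Mathlib

open Polynomial in
/-- A `q`-polynomial of `q`-degree less than `n` vanishing on a field with `q ^ n` elements is
zero. -/
theorem FiniteField.eq_zero_of_sum_mul_pow_pow_eq_zero {F : Type*} [Field F] [Fintype F]
    {q n : ℕ} (hq : 1 < q) (hcard : Fintype.card F = q ^ n) (k : Fin n → F)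
    (h : ∀ x : F, ∑ i, k i * x ^ q ^ (i : ℕ) = 0) : k = 0 := by
  set P : F[X] := ∑ i, C (k i) * X ^ q ^ (i : ℕ) with hP
  have hdeg : P.degree < (Finset.univ : Finset F).card := by
    rw [Finset.card_univ, hcard, ← Polynomial.mem_degreeLT]
    refine Submodule.sum_mem _ fun i _ => Polynomial.mem_degreeLT.2 ?_
    refine (degree_C_mul_X_pow_le _ _).trans_lt ?_
    exact_mod_cast Nat.pow_lt_pow_right hq i.2
  have hP0 : P = 0 := Polynomial.eq_zero_of_degree_lt_of_eval_finset_eq_zero _ hdeg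
    fun x _ => by simpa [hP, eval_finsetSum] using h x
  funext j
  have hj : P.coeff (q ^ (j : ℕ)) = k j := by
    simp [hP, coeff_X_pow, (Nat.pow_right_injective hq).eq_iff,
      Fin.val_inj]
  simpa [hP0] using hj.symm

/-- On a field whose cardinality is a positive power of the prime power `q`, raising to the
power `q` is a ring endomorphism. -/
theorem FiniteField.exists_ringHom_eq_pow {F : Type*} [Field F] [Fintype F] {q n : ℕ}
    (hq : IsPrimePow q) (hcard : Fintype.card F = q ^ n) :
    ∃ σ : F →+* F, ∀ x, σ x = x ^ q := by
  obtain ⟨p, k, hp, -, rfl⟩ := hq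
  have : Fact p.Prime := ⟨hp.nat_prime⟩
  have : CharP F p := charP_of_card_eq_prime_pow (f := k * n) (by rw [hcard, pow_mul])
  exact ⟨iterateFrobenius F p k, fun x => iterateFrobenius_def p k x⟩

/-- The matrix entries of a linear map preserving the subspace attached to
`x ^ q + x ^ q ^ 3 + c * x ^ q ^ 5`: it is diagonal with entries `a` and `a ^ q`,
where `a` lies in the subfield with `q ^ 2` elements. -/
theorem entries_of_preserves {F : Type*} [Field F] [Fintype F] {q : ℕ} (hq : 1 < q)
    (hcard : Fintype.card F = q ^ 6) (h2 : (2 : F) ≠ 0) (σ : F →+* F) (hσ : ∀ x, σ x = x ^ q)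
    {c : F} (hc : c ^ 2 + c = 1) {a b d e : F}
    (h : ∀ x : F, d * x + e * (σ x + σ (σ (σ x)) + c * σ (σ (σ (σ (σ x))))) =
      σ (a * x + b * (σ x + σ (σ (σ x)) + c * σ (σ (σ (σ (σ x)))))) +
      σ (σ (σ (a * x + b * (σ x + σ (σ (σ x)) + c * σ (σ (σ (σ (σ x)))))))) +
      c * σ (σ (σ (σ (σ (a * x + b * (σ x + σ (σ (σ x)) + c * σ (σ (σ (σ (σ x)))))))))) ) :
    b = 0 ∧ d = 0 ∧ e = σ a ∧ σ (σ a) = a := by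
  have hσ6 : ∀ x, σ (σ (σ (σ (σ (σ x))))) = x := fun x => by
    simp only [hσ, ← pow_mul]
    rw [show q * q * q * q * q * q = Fintype.card F by rw [hcard]; ring, FiniteField.pow_card]
  have hC : (σ c) ^ 2 + σ c = 1 := by rw [← map_pow, ← map_add, hc, map_one]
  have hcc : σ (σ c) = c := by
    have h0 : (σ c - c) * (σ c + c + 1) = 0 := by linear_combination hC - hc
    rcases mul_eq_zero.1 h0 with h | h
    · rw [sub_eq_zero.1 h, sub_eq_zero.1 h]
    · have h' : σ c = -1 - c := by linear_combination h
      rw [h', map_sub, map_neg, map_one, h']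
      ring
  have hC1 : σ c ≠ 1 := fun h1 => by
    rw [h1] at hC
    exact one_ne_zero (α := F) (by linear_combination hC)
  have hc0 : c ≠ 0 := by
    rintro rfl
    simp at hc
  have key := FiniteField.eq_zero_of_sum_mul_pow_pow_eq_zero hq hcard
    ![σ c * σ b + σ (σ (σ b)) + c * σ (σ (σ (σ (σ b)))) - d, σ a - e,
      σ b + σ c * σ (σ (σ b)) + c * σ (σ (σ (σ (σ b)))), σ (σ (σ a)) - e,
      σ b + σ (σ (σ b)) + c * σ c * σ (σ (σ (σ (σ b)))),
      c * σ (σ (σ (σ (σ a)))) - c * e] (fun x => by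
    have hx := h x
    simp only [map_add, map_mul, hσ6, hcc] at hx
    have e1 : x ^ q ^ 1 = σ x := by rw [hσ, pow_one]
    have e2 : x ^ q ^ 2 = σ (σ x) := by simp only [hσ, ← pow_mul]; ring_nf
    have e3 : x ^ q ^ 3 = σ (σ (σ x)) := by simp only [hσ, ← pow_mul]; ring_nf
    have e4 : x ^ q ^ 4 = σ (σ (σ (σ x))) := by simp only [hσ, ← pow_mul]; ring_nf
    have e5 : x ^ q ^ 5 = σ (σ (σ (σ (σ x)))) := by simp only [hσ, ← pow_mul]; ring_nf
    rw [Fin.sum_univ_six]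
    simp only [Fin.isValue, Fin.coe_ofNat_eq_mod, Nat.reduceMod,
      pow_zero, e1, e2, e3, e4, e5, Matrix.cons_val]
    linear_combination -hx)
  have k0 : σ c * σ b + σ (σ (σ b)) + c * σ (σ (σ (σ (σ b)))) - d = 0 := congrFun key 0
  have k1 : σ a - e = 0 := congrFun key 1
  have k2 : σ b + σ c * σ (σ (σ b)) + c * σ (σ (σ (σ (σ b)))) = 0 := congrFun key 2
  have k3 : σ (σ (σ a)) - e = 0 := congrFun key 3
  have k4 : σ b + σ (σ (σ b)) + c * σ c * σ (σ (σ (σ (σ b)))) = 0 := congrFun key 4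
  have hb35 : σ (σ (σ b)) = c * σ (σ (σ (σ (σ b)))) := by
    refine sub_eq_zero.1 ((mul_eq_zero.1 ?_).resolve_left (sub_ne_zero.2 hC1))
    linear_combination k2 - k4
  have hb2 : b = σ c * σ (σ b) := by
    simpa only [map_mul, hσ6, hcc] using congrArg (fun t => σ (σ (σ t))) hb35
  have hb4 : σ (σ b) = σ c * σ (σ (σ (σ b))) := by
    simpa only [map_mul, hcc] using congrArg (fun t => σ (σ t)) hb2
  have hb6 : σ (σ (σ (σ b))) = σ c * b := by
    simpa only [map_mul, hcc, hσ6] using congrArg (fun t => σ (σ t)) hb4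
  have hb : b = 0 := by
    refine (mul_eq_zero.1 ?_).resolve_left (mul_ne_zero h2 (sub_ne_zero.2 hC1))
    linear_combination (-1 : F) * hb2 - σ c * hb4 - (σ c) ^ 2 * hb6 - (σ c - 1) * b * hC
  refine ⟨hb, ?_, ?_, ?_⟩
  · simpa [hb] using k0
  · exact (sub_eq_zero.1 k1).symm
  · exact σ.injective (by linear_combination k3 - k1)

/-- A finite field contains `m` solutions of `u ^ m = 1` for every `m` dividing the order of its
multiplicative group. -/
theorem FiniteField.ncard_units_pow_eq_one_of_dvd {F : Type*} [Field F] [Fintype F] {m : ℕ}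
    (h : m ∣ Fintype.card F - 1) : {u : Fˣ | u ^ m = 1}.ncard = m := by
  have := IsCyclic.card_powMonoidHom_ker (G := Fˣ) m
  rw [Nat.card_units, Nat.card_eq_fintype_card (α := F), Nat.gcd_eq_right h] at this
  rw [← Nat.card_coe_set_eq]
  exact this

theorem stmt14 (q : ℕ) (hq : IsPrimePow q) (hodd : Odd q)
    (F : Type*) [Field F] [Fintype F] (hcard : Fintype.card F = q ^ 6)
    (c : F) (hc : c ^ 2 + c = 1)
    (U : Set (F × F))
    (hU : U = {p : F × F | ∃ x : F, p = (x, x ^ q + x ^ (q ^ 3) + c * x ^ (q ^ 5))}) :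
    ({φ : (F × F) ≃ₗ[F] (F × F) | (fun v => φ v) '' U = U} :
        Set ((F × F) ≃ₗ[F] (F × F))).ncard = q ^ 2 - 1 := by
  obtain ⟨σ, hσ⟩ := FiniteField.exists_ringHom_eq_pow hq hcard
  have h2 : (2 : F) ≠ 0 := by
    refine Ring.two_ne_zero fun h => ?_
    have := FiniteField.even_card_of_char_two h
    rw [hcard] at this
    exact Nat.not_even_iff_odd.2 (hodd.pow (n := 6)) (Nat.even_iff.2 this)
  have hσ2 : ∀ x, σ (σ x) = x ^ q ^ 2 := fun x => by simp only [hσ, ← pow_mul]; ring_nf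
  have hU' : ∀ x y : F, (x, y) ∈ U ↔ y = σ x + σ (σ (σ x)) + c * σ (σ (σ (σ (σ x)))) := by
    intro x y
    have e3 : x ^ q ^ 3 = σ (σ (σ x)) := by simp only [hσ, ← pow_mul]; ring_nf
    have e5 : x ^ q ^ 5 = σ (σ (σ (σ (σ x)))) := by simp only [hσ, ← pow_mul]; ring_nf
    simp [hU, ← hσ, e3, e5]
  have hdvd : q ^ 2 - 1 ∣ Fintype.card F - 1 := by
    rw [hcard, show q ^ 6 = (q ^ 2) ^ 3 by ring]
    simpa using Nat.sub_dvd_pow_sub_pow (q ^ 2) 1 3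
  have hpow : ∀ u : Fˣ, u ^ (q ^ 2 - 1) = 1 ↔ σ (σ (u : F)) = u := by
    intro u
    have : (u : F) ^ q ^ 2 = u ^ (q ^ 2 - 1) * u := by
      rw [← pow_succ, Nat.sub_add_cancel (Nat.one_le_pow _ _ hq.pos)]
    rw [hσ2, this, mul_eq_right₀ u.ne_zero, ← Units.val_pow_eq_pow_val, Units.val_eq_one]
  rw [← FiniteField.ncard_units_pow_eq_one_of_dvd hdvd]
  symm
  refine Set.ncard_congr (fun u _ => (LinearEquiv.smulOfUnit u).prodCongr
    (LinearEquiv.smulOfUnit (Units.map (σ : F →* F) u))) ?_ ?_ ?_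
  · intro u hu
    have hu : σ (σ (u : F)) = u := (hpow u).1 hu
    refine Set.eq_of_subset_of_ncard_le ?_ (Set.ncard_image_of_injective U
      (LinearEquiv.injective _)).ge
    rintro _ ⟨⟨x, y⟩, hxy, rfl⟩
    rw [hU'] at hxy
    refine (hU' (u * x) (σ u * y)).2 ?_
    simp only [map_mul, hu, hxy]
    ring
  · intro u v _ _ huv
    have := congrArg Prod.fst (LinearEquiv.congr_fun huv (1, 0))
    refine Units.ext ?_
    simpa [LinearEquiv.smulOfUnit, Units.smul_def] using this
  · intro φ hφ
    obtain ⟨a, d, had⟩ : ∃ a d, φ (1, 0) = (a, d) := ⟨_, _, rfl⟩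
    obtain ⟨b, e, hbe⟩ : ∃ b e, φ (0, 1) = (b, e) := ⟨_, _, rfl⟩
    have hφ' : ∀ x y, φ (x, y) = (a * x + b * y, d * x + e * y) := fun x y => by
      have : ((x, y) : F × F) = x • (1, 0) + y • (0, 1) := by simp
      rw [this, map_add, map_smul, map_smul, had, hbe]
      simp [mul_comm]
    obtain ⟨rfl, rfl, rfl, ha⟩ := entries_of_preserves hq.one_lt hcard h2 σ hσ hc
      (a := a) (b := b) (d := d) (e := e) fun x => by
        refine (hU' _ _).1 ?_
        rw [← hφ', ← (show _ '' U = U from hφ)]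
        exact ⟨_, (hU' _ _).2 rfl, rfl⟩
    have ha0 : a ≠ 0 := by
      rintro rfl
      have : φ (1, 0) = φ 0 := by rw [had, map_zero]; rfl
      simpa using φ.injective this
    refine ⟨Units.mk0 a ha0, (hpow _).2 ha, LinearEquiv.ext fun ⟨x, y⟩ => ?_⟩
    rw [hφ']
    simp [LinearEquiv.smulOfUnit, Units.smul_def]
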